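/- The closed formula F21 satisfies the (g,n) = (2,1) case of the differential topological recursion with inputs F12 and F11: for every nonzero real t with t ≠ ±1 (in fact for all t ≠ 0), F21′(t) = −(1/32) · ((t²−1)³/t²) · [ (∂²/∂u_1∂u_2) F12(u_1, u_2) |_{u_1 = u_2 = t} + F11′(t)·F11′(t) ]. -/

import Mathlib

/-- The Poincaré polynomial `F_{1,1}` of `RG_{1,1}`. -/
noncomputable def F11 (t : ℝ) : ℝ :=
  -(1 / 384) * ((t + 1) ^ 4 / t ^ 2) * (t - 4 + 1 / t)

/-- The Poincaré polynomial `F_{1,2}` of `RG_{1,2}`. -/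
noncomputable def F12 (t1 t2 : ℝ) : ℝ :=
  (1 / 2048) *
    (t1 ^ 5 * t2 + t1 * t2 ^ 5 + t1 ^ 3 * t2 ^ 3 / 3 + t1 ^ 5 + t2 ^ 5 -
      6 * (t1 ^ 3 * t2 + t1 * t2 ^ 3) - (17 / 3) * (t1 ^ 3 + t2 ^ 3) +
      27 * (t1 * t2) + 26 * (t1 + t2) + 128 / 3 + 4 * (t1 / t2 + t2 / t1) +
      26 * (1 / t1 + 1 / t2) + 27 / (t1 * t2) -
      (17 / 3) * (1 / t1 ^ 3 + 1 / t2 ^ 3) -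
      6 * (1 / (t1 * t2 ^ 3) + 1 / (t1 ^ 3 * t2)) +
      (1 / t1 ^ 5 + 1 / t2 ^ 5) + (1 / 3) * (1 / (t1 ^ 3 * t2 ^ 3)) +
      (1 / (t1 * t2 ^ 5) + 1 / (t1 ^ 5 * t2)))

/-- The Poincaré polynomial `F_{2,1}` of `RG_{2,1}`. -/
noncomputable def F21 (t : ℝ) : ℝ :=
  -(1 / 2 ^ 19) * ((t + 1) ^ 8 / t ^ 4) *
    ((35 / 3) * t ^ 5 - (280 / 3) * t ^ 4 + 333 * t ^ 3 - 704 * t ^ 2 +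
      (5018 / 5) * t - 5424 / 5 + (5018 / 5) * t⁻¹ - 704 * t⁻¹ ^ 2 +
      333 * t⁻¹ ^ 3 - (280 / 3) * t⁻¹ ^ 4 + (35 / 3) * t⁻¹ ^ 5)

/-- The derivative of an odd Laurent polynomial of degree at most five plus a constant. -/
theorem hasDerivAt_laurent_five (c c₁ c₃ c₅ d₁ d₃ d₅ : ℝ) {t : ℝ} (h : t ≠ 0) :
    HasDerivAt
      (fun x : ℝ => c + c₁ * x + c₃ * x ^ 3 + c₅ * x ^ 5 + d₁ * x⁻¹ + d₃ * x⁻¹ ^ 3 + d₅ * x⁻¹ ^ 5)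
      (c₁ + 3 * c₃ * t ^ 2 + 5 * c₅ * t ^ 4 - d₁ * t⁻¹ ^ 2 - 3 * d₃ * t⁻¹ ^ 4 -
        5 * d₅ * t⁻¹ ^ 6) t := by
  have hx := hasDerivAt_id' t
  have hi := hasDerivAt_inv h
  refine (((((((hx.const_mul c₁).const_add c).add ((hx.fun_pow 3).const_mul c₃)).add
    ((hx.fun_pow 5).const_mul c₅)).add (hi.const_mul d₁)).add
    ((hi.fun_pow 3).const_mul d₃)).add ((hi.fun_pow 5).const_mul d₅)).congr_deriv ?_
  simp only [Nat.reduceSub, Nat.cast_ofNat]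
  field_simp
  ring

theorem hasDerivAt_F11 {t : ℝ} (h : t ≠ 0) :
    HasDerivAt F11
      (-(1 / 384) * ((4 * (t + 1) ^ 3 / t ^ 2 - 2 * (t + 1) ^ 4 / t ^ 3) * (t - 4 + 1 / t) +
        (t + 1) ^ 4 / t ^ 2 * (1 - 1 / t ^ 2))) t := by
  have hx := hasDerivAt_id' t
  have hq := ((hx.add_const 1).fun_pow 4).fun_div (hx.fun_pow 2) (pow_ne_zero 2 h)
  have hp := (hx.sub_const 4).fun_add ((hasDerivAt_const t (1 : ℝ)).fun_div hx h)
  refine ((hq.const_mul (-(1 / 384))).fun_mul hp).congr_deriv ?_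
  simp only [Nat.reduceSub, Nat.cast_ofNat]
  field_simp
  ring

theorem deriv_F12_right (u : ℝ) {t : ℝ} (h : t ≠ 0) :
    deriv (fun v => F12 u v) t =
      (1 / 2048) *
        ((u ^ 5 - 6 * u ^ 3 + 27 * u + 26 + 4 * u⁻¹) + 3 * (u ^ 3 / 3 - 6 * u - 17 / 3) * t ^ 2 +
          5 * (u + 1) * t ^ 4 - (4 * u + 26 + 27 * u⁻¹ - 6 * u⁻¹ ^ 3 + u⁻¹ ^ 5) * t⁻¹ ^ 2 -
          3 * (u⁻¹ ^ 3 / 3 - 6 * u⁻¹ - 17 / 3) * t⁻¹ ^ 4 - 5 * (u⁻¹ + 1) * t⁻¹ ^ 6) := by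
  refine HasDerivAt.deriv (HasDerivAt.congr_of_eventuallyEq
    ((hasDerivAt_laurent_five
      (u ^ 5 - (17 / 3) * u ^ 3 + 26 * u + 128 / 3 + 26 * u⁻¹ - (17 / 3) * u⁻¹ ^ 3 + u⁻¹ ^ 5)
      (u ^ 5 - 6 * u ^ 3 + 27 * u + 26 + 4 * u⁻¹) (u ^ 3 / 3 - 6 * u - 17 / 3) (u + 1)
      (4 * u + 26 + 27 * u⁻¹ - 6 * u⁻¹ ^ 3 + u⁻¹ ^ 5) (u⁻¹ ^ 3 / 3 - 6 * u⁻¹ - 17 / 3)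
      (u⁻¹ + 1) h).const_mul (1 / 2048)) (.of_forall fun v => ?_))
  simp only [F12, div_eq_mul_inv, mul_inv, inv_pow]
  ring

theorem deriv_deriv_F12 {t : ℝ} (h : t ≠ 0) :
    deriv (fun u => deriv (fun v => F12 u v) t) t =
      (1 / 2048) *
        (13 * t ^ 4 - 36 * t ^ 2 + 27 - 8 * t⁻¹ ^ 2 + 27 * t⁻¹ ^ 4 - 36 * t⁻¹ ^ 6 +
          13 * t⁻¹ ^ 8) := by
  simp only [deriv_F12_right _ h]
  refine HasDerivAt.deriv (((HasDerivAt.congr_of_eventuallyEq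
    (hasDerivAt_laurent_five
      (26 - 17 * t ^ 2 + 5 * t ^ 4 - 26 * t⁻¹ ^ 2 + 17 * t⁻¹ ^ 4 - 5 * t⁻¹ ^ 6)
      (27 - 18 * t ^ 2 + 5 * t ^ 4 - 4 * t⁻¹ ^ 2) (t ^ 2 - 6) 1
      (4 - 27 * t⁻¹ ^ 2 + 18 * t⁻¹ ^ 4 - 5 * t⁻¹ ^ 6) (6 * t⁻¹ ^ 2 - t⁻¹ ^ 4)
      (-t⁻¹ ^ 2) h) (.of_forall fun u => ?_)).const_mul (1 / 2048)).congr_deriv ?_)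
  all_goals ring

theorem hasDerivAt_F21 {t : ℝ} (h : t ≠ 0) :
    HasDerivAt F21
      (-(1 / 2 ^ 19) * ((8 * (t + 1) ^ 7 / t ^ 4 - 4 * (t + 1) ^ 8 / t ^ 5) *
          ((35 / 3) * t ^ 5 - (280 / 3) * t ^ 4 + 333 * t ^ 3 - 704 * t ^ 2 +
            (5018 / 5) * t - 5424 / 5 + (5018 / 5) * t⁻¹ - 704 * t⁻¹ ^ 2 +
            333 * t⁻¹ ^ 3 - (280 / 3) * t⁻¹ ^ 4 + (35 / 3) * t⁻¹ ^ 5) +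
        (t + 1) ^ 8 / t ^ 4 *
          ((175 / 3) * t ^ 4 - (1120 / 3) * t ^ 3 + 999 * t ^ 2 - 1408 * t + 5018 / 5 -
            (5018 / 5) * t⁻¹ ^ 2 + 1408 * t⁻¹ ^ 3 - 999 * t⁻¹ ^ 4 + (1120 / 3) * t⁻¹ ^ 5 -
            (175 / 3) * t⁻¹ ^ 6))) t := by
  have hx := hasDerivAt_id' t
  have hi := hasDerivAt_inv h
  have hq := ((hx.add_const 1).fun_pow 8).fun_div (hx.fun_pow 4) (pow_ne_zero 4 h)
  have hp := ((((((((((hx.fun_pow 5).const_mul (35 / 3)).fun_sub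
    ((hx.fun_pow 4).const_mul (280 / 3))).fun_add ((hx.fun_pow 3).const_mul 333)).fun_sub
    ((hx.fun_pow 2).const_mul 704)).fun_add (hx.const_mul (5018 / 5))).sub_const
    (5424 / 5)).fun_add (hi.const_mul (5018 / 5))).fun_sub
    ((hi.fun_pow 2).const_mul 704)).fun_add ((hi.fun_pow 3).const_mul 333)).fun_sub
    ((hi.fun_pow 4).const_mul (280 / 3)) |>.fun_add ((hi.fun_pow 5).const_mul (35 / 3))
  refine ((hq.const_mul (-(1 / 2 ^ 19))).fun_mul hp).congr_deriv ?_
  simp only [Nat.reduceSub, Nat.cast_ofNat]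
  field_simp
  ring

/-- The closed formula `F_{2,1}` satisfies the `(g,n) = (2,1)` case of the
differential topological recursion with inputs `F_{1,2}` and `F_{1,1}`. -/
theorem F21_recursion (t : ℝ) (h : t ≠ 0) :
    deriv F21 t =
      -(1 / 32) * ((t ^ 2 - 1) ^ 3 / t ^ 2) *
        (deriv (fun u1 => deriv (fun u2 => F12 u1 u2) t) t +
          deriv F11 t * deriv F11 t) := by
  rw [(hasDerivAt_F21 h).deriv, deriv_deriv_F12 h, (hasDerivAt_F11 h).deriv]
  field_simp
  ring
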